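/- arXiv:1907.12472 — 2 statements merged into one kernel-verified Lean document; each statement's English description precedes it below -/
import Mathlib

section
/- Let w = ((i_1,ε_1),…,(i_m,ε_m)) be a signed word over n letters and let i ≠ j be indices in {1,…,n}. Let P : [0,m] → ℝ² be the piecewise-linear curve of the lattice path γ_{ij}(w). Then the line integral ∮ x dy along P, i.e. ∫_0^m P₁(t)·P₂′(t) dt (the derivative of the second coordinate exists away from the finitely many integer points, which form a measure-zero set), equals e_{ij}(w). -/
/-- `eij w i j` is the signed count of occurrences of the letter `i` appearing
(weakly) before an occurrence of the letter `j` in the signed word `w`: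
`∑_{1 ≤ u ≤ v ≤ m} δ(i_u, i) · δ(i_v, j) · ε_u · ε_v`. -/
def eij (w : List (ℕ × ℤ)) (i j : ℕ) : ℤ :=
  ∑ v : Fin w.length, ∑ u : Fin w.length,
    if u ≤ v ∧ (w.get u).1 = i ∧ (w.get v).1 = j
    then (w.get u).2 * (w.get v).2 else 0

/-- The lattice path `γ_{ij}(w)`: each letter `(i, ε)` becomes the step `(ε, 0)`,
each letter `(j, ε)` becomes the step `(0, ε)`, all other letters are deleted. -/
def gammaPath (w : List (ℕ × ℤ)) (i j : ℕ) : List (ℤ × ℤ) :=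
  w.filterMap (fun p =>
    if p.1 = i then some (p.2, (0 : ℤ))
    else if p.1 = j then some ((0 : ℤ), p.2) else none)

/-- The `k`-th vertex of a lattice path, as a point of `ℝ²`:
`p_0 = (0,0)` and `p_k = s_1 + ⋯ + s_k`. -/
noncomputable def pathVertex (s : List (ℤ × ℤ)) (k : ℕ) : ℝ × ℝ :=
  ((((s.take k).sum).1 : ℝ), (((s.take k).sum).2 : ℝ))

/-- Discrete version of the line integral `∮ x dy` of a lattice path. -/
def discreteInt (s : List (ℤ × ℤ)) : ℤ :=
  ∑ k ∈ Finset.range s.length,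
    ((s.take k).sum).1 * (((s.take (k + 1)).sum).2 - ((s.take k).sum).2)

theorem discreteInt_cons (a : ℤ × ℤ) (s : List (ℤ × ℤ)) :
    discreteInt (a :: s) = a.1 * s.sum.2 + discreteInt s := by
  unfold discreteInt
  rw [List.length_cons, Finset.sum_range_succ']
  have h := Finset.sum_range_sub (fun k => ((s.take k).sum).2) s.length
  simp only [List.take_length, List.take_zero, List.sum_nil, Prod.snd_zero, sub_zero] at h
  rw [← h, Finset.mul_sum, ← Finset.sum_add_distrib]
  simp only [List.take_succ_cons, List.sum_cons, List.take_zero, List.sum_nil, Prod.fst_zero,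
    zero_mul, add_zero, Prod.fst_add, Prod.snd_add]
  apply Finset.sum_congr rfl
  intro k _
  ring

theorem gammaPath_sum_snd (w : List (ℕ × ℤ)) (i j : ℕ) (hij : i ≠ j) :
    (gammaPath w i j).sum.2
      = ∑ v : Fin w.length, if (w.get v).1 = j then (w.get v).2 else 0 := by
  induction w with
  | nil => simp [gammaPath]
  | cons p w ih =>
    simp only [List.length_cons]
    rw [Fin.sum_univ_succ]
    change _ = (if p.1 = j then p.2 else 0) +
      ∑ v : Fin w.length, (if (w.get v).1 = j then (w.get v).2 else 0)
    rw [← ih]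
    unfold gammaPath
    rw [List.filterMap_cons]
    by_cases h1 : p.1 = i
    · have h2 : p.1 ≠ j := fun h => hij (h1.symm.trans h)
      simp [h1, hij]
    · by_cases h2 : p.1 = j
      · simp [h2, hij.symm]
      · simp [h1, h2]

theorem eij_cons (p : ℕ × ℤ) (w : List (ℕ × ℤ)) (i j : ℕ) (hij : i ≠ j) :
    eij (p :: w) i j = (if p.1 = i then p.2 else 0) *
      (∑ v : Fin w.length, if (w.get v).1 = j then (w.get v).2 else 0) + eij w i j := by
  unfold eij
  simp only [List.length_cons]
  rw [Fin.sum_univ_succ, Fin.sum_univ_succ]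
  simp only [Fin.sum_univ_succ (n := w.length), List.get_cons_zero, List.get_cons_succ]
  have h0 : ¬ (p.1 = i ∧ p.1 = j) := fun h => hij (h.1.symm.trans h.2)
  simp only [le_refl, true_and, h0, if_false, Fin.succ_le_succ_iff, Fin.zero_le,
    Fin.le_zero_iff, Fin.succ_ne_zero, false_and, Finset.sum_const_zero, zero_add,
    Finset.sum_add_distrib, Finset.mul_sum]
  congr 1
  apply Finset.sum_congr rfl
  intro v _
  by_cases h1 : p.1 = i <;> by_cases h2 : (w.get v).1 = j <;> simp_all

theorem discreteInt_gammaPath (w : List (ℕ × ℤ)) (i j : ℕ) (hij : i ≠ j) :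
    discreteInt (gammaPath w i j) = eij w i j := by
  induction w with
  | nil => simp [gammaPath, discreteInt, eij]
  | cons p w ih =>
    rw [eij_cons p w i j hij, ← ih, ← gammaPath_sum_snd w i j hij]
    by_cases h1 : p.1 = i
    · have h : gammaPath (p :: w) i j = (p.2, 0) :: gammaPath w i j := by
        simp [gammaPath, h1]
      rw [h, discreteInt_cons]
      simp [h1]
    · by_cases h2 : p.1 = j
      · have h : gammaPath (p :: w) i j = (0, p.2) :: gammaPath w i j := by
          simp [gammaPath, h2, hij.symm]
        rw [h, discreteInt_cons]
        simp [h1]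
      · have h : gammaPath (p :: w) i j = gammaPath w i j := by
          simp [gammaPath, h1, h2]
        rw [h]
        simp [h1]

theorem step_mul_zero (w : List (ℕ × ℤ)) (i j : ℕ) :
    ∀ a ∈ gammaPath w i j, a.1 * a.2 = 0 := by
  intro a ha
  unfold gammaPath at ha
  rw [List.mem_filterMap] at ha
  obtain ⟨p, _, hp⟩ := ha
  split_ifs at hp
  · simp at hp; simp [← hp]
  · simp at hp; simp [← hp]

theorem vertex_step_mul_zero (s : List (ℤ × ℤ)) (hs : ∀ a ∈ s, a.1 * a.2 = 0) (k : ℕ)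
    (hk : k < s.length) :
    ((pathVertex s (k + 1)).1 - (pathVertex s k).1) *
      ((pathVertex s (k + 1)).2 - (pathVertex s k).2) = 0 := by
  have h := hs s[k] (List.getElem_mem hk)
  have h' : ((s[k].1 : ℤ) : ℝ) * ((s[k].2 : ℤ) : ℝ) = 0 := by exact_mod_cast h
  simp only [pathVertex, List.sum_take_succ s k hk, Prod.fst_add, Prod.snd_add, Int.cast_add,
    add_sub_cancel_left]
  exact h'

theorem piece_eq (s : List (ℤ × ℤ)) (hs : ∀ a ∈ s, a.1 * a.2 = 0) (P : ℝ → ℝ × ℝ) (k : ℕ)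
    (hk : k < s.length)
    (hP : ∀ t ∈ Set.Icc (k : ℝ) ((k : ℝ) + 1),
      P t = pathVertex s k + (t - (k : ℝ)) • (pathVertex s (k + 1) - pathVertex s k))
    (t : ℝ) (ht : t ∈ Set.Ioo (k : ℝ) ((k : ℝ) + 1)) :
    (P t).1 * deriv (fun s => (P s).2) t =
      (pathVertex s k).1 * ((pathVertex s (k + 1)).2 - (pathVertex s k).2) := by
  have hd : deriv (fun s => (P s).2) t = (pathVertex s (k + 1)).2 - (pathVertex s k).2 := by
    have he : (fun s => (P s).2) =ᶠ[nhds t] fun r => (pathVertex s k).2 +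
        (r - (k : ℝ)) * ((pathVertex s (k + 1)).2 - (pathVertex s k).2) := by
      filter_upwards [Ioo_mem_nhds ht.1 ht.2] with r hr
      rw [hP r (Set.Ioo_subset_Icc_self hr)]
      simp
    rw [he.deriv_eq]
    have := (((hasDerivAt_id t).sub_const (k : ℝ)).mul_const
      ((pathVertex s (k + 1)).2 - (pathVertex s k).2)).const_add (pathVertex s k).2
    simpa using this.deriv
  rw [hd, hP t (Set.Ioo_subset_Icc_self ht)]
  have h0 := vertex_step_mul_zero s hs k hk
  simp only [Prod.fst_add, Prod.smul_fst, Prod.fst_sub, smul_eq_mul]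
  linear_combination (t - (k : ℝ)) * h0

/-- If `w` is a signed word over `n` letters, `i ≠ j` are letters, and
`P` is the piecewise-linear curve of the lattice path `γ_{ij}(w)` (affine linear on each
interval `[k, k+1]`, interpolating the vertices of the path), then the line integral
`∮ x dy = ∫_0^m P₁(t) · P₂′(t) dt` along `P` equals `e_{ij}(w)`. -/
theorem lineIntegral_eq_eij (n : ℕ) (w : List (ℕ × ℤ))
    (hw : ∀ p ∈ w, p.1 ∈ Finset.Icc 1 n ∧ (p.2 = 1 ∨ p.2 = -1))
    (i j : ℕ) (hi : i ∈ Finset.Icc 1 n) (hj : j ∈ Finset.Icc 1 n) (hij : i ≠ j)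
    (P : ℝ → ℝ × ℝ)
    (hP : ∀ k : ℕ, k < (gammaPath w i j).length → ∀ t ∈ Set.Icc (k : ℝ) ((k : ℝ) + 1),
      P t = pathVertex (gammaPath w i j) k
        + (t - (k : ℝ)) • (pathVertex (gammaPath w i j) (k + 1)
            - pathVertex (gammaPath w i j) k)) :
    ∫ t in (0 : ℝ)..((gammaPath w i j).length : ℝ),
      (P t).1 * deriv (fun s => (P s).2) t = (eij w i j : ℝ) := by
  have hs := step_mul_zero w i j
  have hD := discreteInt_gammaPath w i j hij
  generalize gammaPath w i j = s at *
  have hae : ∀ k < s.length, ∀ᵐ t ∂MeasureTheory.volume,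
      t ∈ Set.uIoc (k : ℝ) ((k + 1 : ℕ) : ℝ) → (P t).1 * deriv (fun s => (P s).2) t =
      (pathVertex s k).1 * ((pathVertex s (k + 1)).2 - (pathVertex s k).2) := by
    intro k hk
    filter_upwards [MeasureTheory.Measure.ae_ne MeasureTheory.volume ((k : ℝ) + 1)] with t ht1 ht
    have hle : (k : ℝ) ≤ ((k + 1 : ℕ) : ℝ) := by push_cast; linarith
    rw [Set.uIoc_of_le hle] at ht
    push_cast at ht
    exact piece_eq s hs P k hk (hP k hk) t ⟨ht.1, lt_of_le_of_ne ht.2 ht1⟩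
  have hsum := intervalIntegral.sum_integral_adjacent_intervals
    (μ := MeasureTheory.volume) (f := fun t => (P t).1 * deriv (fun s => (P s).2) t)
    (a := fun k : ℕ => (k : ℝ)) (n := s.length) (by
      intro k hk
      refine (intervalIntegrable_const (c := (pathVertex s k).1 *
        ((pathVertex s (k + 1)).2 - (pathVertex s k).2))).congr_ae ?_
      rw [Filter.EventuallyEq, MeasureTheory.ae_restrict_iff' measurableSet_uIoc]
      filter_upwards [hae k hk] with t ht h
      exact (ht h).symm)
  simp only [Nat.cast_zero] at hsum
  rw [← hsum, ← hD, discreteInt, Int.cast_sum]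
  apply Finset.sum_congr rfl
  intro k hk
  rw [intervalIntegral.integral_congr_ae (hae k (Finset.mem_range.mp hk)),
    intervalIntegral.integral_const]
  simp [pathVertex]
end

section
/- Let w_1, w_2, w_3 be signed words over the 3 letters {1,2,3} such that: (a) for each k, the letter k does not occur in w_k; (b) for every k and every letter i ≠ k, the signed count of occurrences of the letter i in w_k is zero; and (c) for each k, the length of w_k is at most the sum of the lengths of the other two words. Set μ := e_{23}(w_1) + e_{31}(w_2) + e_{12}(w_3). Then |w_1| + |w_2| + |w_3| ≥ 4·⌈2·√(|μ|/3)⌉, where |w_k| denotes the length of w_k and ⌈−⌉ is the ceiling function. -/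
/-- The signed count of occurrences of the letter `i` in the signed word `w`:
`∑_{v : i_v = i} ε_v`. -/
def signedCount (w : List (ℕ × ℤ)) (i : ℕ) : ℤ :=
  ∑ v : Fin w.length, if (w.get v).1 = i then (w.get v).2 else 0

theorem signedCount_cons_aux (p : ℕ × ℤ) (w : List (ℕ × ℤ)) (i : ℕ) :
    signedCount (p :: w) i = (if p.1 = i then p.2 else 0) + signedCount w i := by
  unfold signedCount
  exact Fin.sum_univ_succ (n := w.length)
    (fun v => if ((p :: w).get v).1 = i then ((p :: w).get v).2 else 0)

theorem eij_cons_aux (p : ℕ × ℤ) (w : List (ℕ × ℤ)) (i j : ℕ) (hij : i ≠ j) :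
    eij (p :: w) i j = (if p.1 = i then p.2 * signedCount w j else 0) + eij w i j := by
  have h1 : eij (p :: w) i j = ∑ v : Fin (w.length + 1), ∑ u : Fin (w.length + 1),
    if u ≤ v ∧ ((p :: w).get u).1 = i ∧ ((p :: w).get v).1 = j
    then ((p :: w).get u).2 * ((p :: w).get v).2 else 0 := rfl
  rw [h1, Fin.sum_univ_succ]
  have h0 : (∑ u : Fin (w.length + 1),
    if u ≤ 0 ∧ ((p :: w).get u).1 = i ∧ ((p :: w).get 0).1 = j
    then ((p :: w).get u).2 * ((p :: w).get 0).2 else 0) = 0 := by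
    apply Finset.sum_eq_zero
    intro u _
    rw [if_neg]
    rintro ⟨hu, h2, h3⟩
    have : u = 0 := Fin.le_zero_iff.mp hu
    subst this
    exact hij (h2.symm.trans h3)
  rw [h0, zero_add]
  simp_rw [Fin.sum_univ_succ]
  rw [Finset.sum_add_distrib]
  congr 1
  · unfold signedCount
    by_cases hp : p.1 = i
    · simp [hp, Finset.mul_sum]
    · simp [hp]
  · unfold eij
    simp

theorem walk_aux (i j : ℕ) (hij : i ≠ j) (w : List (ℕ × ℤ))
    (hw : ∀ p ∈ w, (p.1 = i ∨ p.1 = j) ∧ (p.2 = 1 ∨ p.2 = -1)) :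
    ∀ x : ℤ, ∃ lo hi a b : ℤ, 0 ≤ a ∧ 0 ≤ b ∧ a + b = w.length ∧
      lo ≤ x ∧ x ≤ hi ∧ lo ≤ x + signedCount w i ∧ x + signedCount w i ≤ hi ∧
      2 * (hi - lo) ≤ a + |signedCount w i| ∧
      (∃ k, signedCount w i + signedCount w j + 2 * k = w.length) ∧
      ∀ l h, l ≤ lo → hi ≤ h →
        |2 * (x * signedCount w j + eij w i j) - (l + h) * signedCount w j| ≤ (h - l) * b := by
  induction w with
  | nil =>
    intro x
    refine ⟨x, x, 0, 0, ?_⟩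
    simp [signedCount, eij]
  | cons p w ih =>
    intro x
    have ih := ih (fun q hq => hw q (List.mem_cons_of_mem _ hq))
    obtain ⟨hl, hs⟩ := hw p List.mem_cons_self
    rw [signedCount_cons_aux, signedCount_cons_aux, eij_cons_aux _ _ _ _ hij]
    push_cast [List.length_cons]
    rcases hl with hl | hl
    · have hj : p.1 ≠ j := fun h => hij (hl.symm.trans h)
      simp only [hl, hij, if_true, if_false, zero_add]
      obtain ⟨lo, hi, a, b, ha, hb, hab, h1, h2, h3, h4, h5, ⟨k, hk⟩, h6⟩ := ih (x + p.2)
      refine ⟨min lo x, max hi x, a + 1, b, by omega, hb, by omega, by omega, by omega, by omega,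
        by omega, ?_, ?_, ?_⟩
      · generalize signedCount w i = s at *
        rcases abs_cases s with ⟨hs1, hs2⟩ | ⟨hs1, hs2⟩ <;>
          rcases abs_cases (p.2 + s) with ⟨hs3, hs4⟩ | ⟨hs3, hs4⟩ <;>
          rw [hs1] at h5 <;> rw [hs3] <;> rcases hs with hs | hs <;> omega
      · rcases hs with hs | hs
        · exact ⟨k, by omega⟩
        · exact ⟨k + 1, by omega⟩
      · intro l h hl hh
        have := h6 l h (by omega) (by omega)
        convert this using 2
        ring
    · have hj : j ≠ i := fun h => hij h.symm
      simp only [hl, hj, if_true, if_false, zero_add]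
      obtain ⟨lo, hi, a, b, ha, hb, hab, h1, h2, h3, h4, h5, ⟨k, hk⟩, h6⟩ := ih x
      refine ⟨lo, hi, a, b + 1, by omega, by omega, by omega, by omega, by omega, by omega,
        by omega, h5, ?_, ?_⟩
      · rcases hs with hs | hs
        · exact ⟨k, by omega⟩
        · exact ⟨k + 1, by omega⟩
      · intro l h hl hh
        have := h6 l h (by omega) (by omega)
        rw [abs_le] at this ⊢
        rcases hs with hs | hs <;> rw [hs] <;> constructor <;> nlinarith

theorem area_aux (i j : ℕ) (hij : i ≠ j) (w : List (ℕ × ℤ))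
    (hw : ∀ p ∈ w, (p.1 = i ∨ p.1 = j) ∧ (p.2 = 1 ∨ p.2 = -1))
    (hi0 : signedCount w i = 0) (hj0 : signedCount w j = 0) :
    ∃ m : ℤ, 0 ≤ m ∧ (w.length : ℤ) = 2 * m ∧ 4 * |eij w i j| ≤ m ^ 2 := by
  obtain ⟨lo, hi, a, b, ha, hb, hab, h1, h2, h3, h4, h5, ⟨k, hk⟩, h6⟩ := walk_aux i j hij w hw 0
  have h7 := h6 lo hi le_rfl le_rfl
  simp only [hi0, hj0, mul_zero, zero_add, sub_zero, abs_zero, add_zero, abs_mul] at *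
  refine ⟨k, by omega, by omega, ?_⟩
  have h8 : 2 * (hi - lo) * b ≤ a * b := mul_le_mul_of_nonneg_right h5 hb
  have h9 : |(2 : ℤ)| = 2 := rfl
  rw [h9] at h7
  have : 2 * k = a + b := by omega
  nlinarith [sq_nonneg (a - b)]

/-- combinatorial core of Theorem 1.3. If `w₁, w₂, w₃` are signed
words over the letters `{1,2,3}` such that (a) the letter `k` does not occur in `wₖ`,
(b) for every `k` and every letter `i ≠ k` the signed count of occurrences of `i` in
`wₖ` is zero, and (c) each word is no longer than the other two combined, then with
`μ = e₂₃(w₁) + e₃₁(w₂) + e₁₂(w₃)` we have `|w₁| + |w₂| + |w₃| ≥ 4⌈2√(|μ|/3)⌉`. -/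
theorem sum_length_ge_of_triple (w₁ w₂ w₃ : List (ℕ × ℤ))
    (hw₁ : ∀ p ∈ w₁, p.1 ∈ ({1, 2, 3} : Set ℕ) ∧ (p.2 = 1 ∨ p.2 = -1))
    (hw₂ : ∀ p ∈ w₂, p.1 ∈ ({1, 2, 3} : Set ℕ) ∧ (p.2 = 1 ∨ p.2 = -1))
    (hw₃ : ∀ p ∈ w₃, p.1 ∈ ({1, 2, 3} : Set ℕ) ∧ (p.2 = 1 ∨ p.2 = -1))
    (ha₁ : ∀ p ∈ w₁, p.1 ≠ 1) (ha₂ : ∀ p ∈ w₂, p.1 ≠ 2) (ha₃ : ∀ p ∈ w₃, p.1 ≠ 3)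
    (hb₁ : ∀ i ∈ ({1, 2, 3} : Set ℕ), i ≠ 1 → signedCount w₁ i = 0)
    (hb₂ : ∀ i ∈ ({1, 2, 3} : Set ℕ), i ≠ 2 → signedCount w₂ i = 0)
    (hb₃ : ∀ i ∈ ({1, 2, 3} : Set ℕ), i ≠ 3 → signedCount w₃ i = 0)
    (hc₁ : w₁.length ≤ w₂.length + w₃.length)
    (hc₂ : w₂.length ≤ w₁.length + w₃.length)
    (hc₃ : w₃.length ≤ w₁.length + w₂.length)
    (μ : ℤ) (hμ : μ = eij w₁ 2 3 + eij w₂ 3 1 + eij w₃ 1 2) :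
    ((w₁.length : ℤ) + w₂.length + w₃.length)
      ≥ 4 * ⌈2 * Real.sqrt (|(μ : ℝ)| / 3)⌉ := by
  have H₁ := area_aux 2 3 (by norm_num) w₁ (fun p hp => ⟨by
    have := (hw₁ p hp).1; have := ha₁ p hp; simp at *; omega, (hw₁ p hp).2⟩)
    (hb₁ 2 (by simp) (by norm_num)) (hb₁ 3 (by simp) (by norm_num))
  have H₂ := area_aux 3 1 (by norm_num) w₂ (fun p hp => ⟨by
    have := (hw₂ p hp).1; have := ha₂ p hp; simp at *; omega, (hw₂ p hp).2⟩)
    (hb₂ 3 (by simp) (by norm_num)) (hb₂ 1 (by simp) (by norm_num))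
  have H₃ := area_aux 1 2 (by norm_num) w₃ (fun p hp => ⟨by
    have := (hw₃ p hp).1; have := ha₃ p hp; simp at *; omega, (hw₃ p hp).2⟩)
    (hb₃ 1 (by simp) (by norm_num)) (hb₃ 2 (by simp) (by norm_num))
  obtain ⟨m₁, p₁, l₁, e₁⟩ := H₁
  obtain ⟨m₂, p₂, l₂, e₂⟩ := H₂
  obtain ⟨m₃, p₃, l₃, e₃⟩ := H₃
  obtain ⟨n, hn⟩ : ∃ n, n = (m₁ + m₂ + m₃) / 2 := ⟨_, rfl⟩
  have hn0 : 0 ≤ n := by omega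
  have q₁ : m₁ ^ 2 ≤ n ^ 2 := pow_le_pow_left₀ p₁ (by omega) 2
  have q₂ : m₂ ^ 2 ≤ n ^ 2 := pow_le_pow_left₀ p₂ (by omega) 2
  have q₃ : m₃ ^ 2 ≤ n ^ 2 := pow_le_pow_left₀ p₃ (by omega) 2
  have hμ' : 4 * |μ| ≤ 3 * n ^ 2 := by
    have := abs_add_three (eij w₁ 2 3) (eij w₂ 3 1) (eij w₃ 1 2)
    rw [hμ]
    linarith
  have hceil : ⌈2 * Real.sqrt (|(μ : ℝ)| / 3)⌉ ≤ n := by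
    rw [Int.ceil_le]
    have hr : 4 * |(μ : ℝ)| ≤ 3 * (n : ℝ) ^ 2 := by exact_mod_cast hμ'
    have hnr : (0 : ℝ) ≤ n := by exact_mod_cast hn0
    have : Real.sqrt (|(μ : ℝ)| / 3) ≤ n / 2 := by
      apply Real.sqrt_le_iff.mpr
      constructor
      · positivity
      · nlinarith
    linarith
  omega
end
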